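/- Let (P_t)_{t≥0} be a Feller, stochastically continuous Markov transition semigroup on a Polish metric space 𝒳 that has the e-property, and suppose there exists z ∈ 𝒳 such that: (i) for every bounded set A ⊆ 𝒳 and every δ > 0, inf_{x∈A} liminf_{T→∞} Q^T(x, B(z,δ)) > 0; and (ii) for every ε > 0 and every x ∈ 𝒳 there exists a bounded Borel set D ⊆ 𝒳 with liminf_{T→∞} Q^T(x,D) > 1 − ε. Then the semigroup admits a unique invariant probability measure μ* and is weak-* mean ergodic: Q^T ν converges weakly to μ* as T → ∞ for every Borel probability measure ν on 𝒳. -/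

import Mathlib

open MeasureTheory Filter Topology Metric Set

noncomputable section

/-- A Markov transition semigroup on a measurable space `X`: a jointly measurable family
of Markov probability kernels `P t x` with `P 0 x = δ_x` and the Chapman–Kolmogorov
semigroup property for nonnegative times. -/
structure MarkovSemigroup (X : Type*) [MeasurableSpace X] where
  P : ℝ → X → MeasureTheory.Measure X
  prob : ∀ t x, MeasureTheory.IsProbabilityMeasure (P t x)
  meas : Measurable fun p : ℝ × X => P p.1 p.2
  init : ∀ x : X, P 0 x = MeasureTheory.Measure.dirac x
  semigroup : ∀ t s : ℝ, 0 ≤ t → 0 ≤ s → ∀ x : X,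
    P (t + s) x = (P t x).bind (P s)

namespace MarkovSemigroup

variable {X : Type*} [MeasurableSpace X]

/-- Action `P_t f(x) = ∫ f(y) P_t(x,dy)` on functions. -/
def act (M : MarkovSemigroup X) (t : ℝ) (f : X → ℝ) (x : X) : ℝ :=
  ∫ y, f y ∂(M.P t x)

/-- Dual action `P_t^* μ` on measures. -/
def dual (M : MarkovSemigroup X) (t : ℝ) (μ : MeasureTheory.Measure X) :
    MeasureTheory.Measure X :=
  μ.bind (M.P t)

/-- The time average `Q^T μ = (1/T) ∫_0^T P_s^* μ ds` (with the convention
`Q^T μ = μ` for `T ≤ 0`). -/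
def QM (M : MarkovSemigroup X) (T : ℝ) (μ : MeasureTheory.Measure X) :
    MeasureTheory.Measure X :=
  if T ≤ 0 then μ
  else ((ENNReal.ofReal (1 / T)) • (volume.restrict (Set.Ioc (0 : ℝ) T))).bind
    fun s => M.dual s μ

/-- `Q^T(x,·) := Q^T δ_x`. -/
def Q (M : MarkovSemigroup X) (T : ℝ) (x : X) : MeasureTheory.Measure X :=
  M.QM T (MeasureTheory.Measure.dirac x)

/-- Iterated averages: for `ts = [t_k, …, t_1]`, `QMs ts μ = Q^{t_k}(⋯(Q^{t_1} μ)⋯)`. -/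
def QMs (M : MarkovSemigroup X) (ts : List ℝ) (μ : MeasureTheory.Measure X) :
    MeasureTheory.Measure X :=
  ts.foldr (fun t ν => M.QM t ν) μ

/-- A measure is invariant if `P_t^* μ = μ` for all `t ≥ 0`. -/
def Invariant (M : MarkovSemigroup X) (μ : MeasureTheory.Measure X) : Prop :=
  ∀ t : ℝ, 0 ≤ t → M.dual t μ = μ

section TopologicalDefs

variable [TopologicalSpace X]

/-- Bounded continuous real functions. -/
def IsBddContinuous (f : X → ℝ) : Prop :=
  Continuous f ∧ ∃ C : ℝ, ∀ x, |f x| ≤ C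

/-- The Feller property: `P_t` maps bounded continuous functions to continuous ones. -/
def Feller (M : MarkovSemigroup X) : Prop :=
  ∀ t : ℝ, 0 ≤ t → ∀ f : X → ℝ, MarkovSemigroup.IsBddContinuous f →
    Continuous (M.act t f)

/-- Stochastic continuity: `P_t f(x) → f(x)` as `t → 0+`. -/
def StochasticallyContinuous (M : MarkovSemigroup X) : Prop :=
  ∀ f : X → ℝ, MarkovSemigroup.IsBddContinuous f → ∀ x : X,
    Filter.Tendsto (fun t : ℝ => M.act t f x) (nhdsWithin 0 (Set.Ioi 0)) (nhds (f x))

/-- Weak convergence of `Q^T ν` to `μ` as `T → ∞`. -/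
def QTendsto (M : MarkovSemigroup X) (ν μ : MeasureTheory.Measure X) : Prop :=
  ∀ f : X → ℝ, MarkovSemigroup.IsBddContinuous f →
    Filter.Tendsto (fun T : ℝ => ∫ x, f x ∂(M.QM T ν)) Filter.atTop
      (nhds (∫ x, f x ∂μ))

/-- Weak-* mean ergodicity with limit `μstar`. -/
def WeakStarMeanErgodic (M : MarkovSemigroup X) (μstar : MeasureTheory.Measure X) : Prop :=
  ∀ ν : MeasureTheory.Measure X, MeasureTheory.IsProbabilityMeasure ν → M.QTendsto ν μstar

/-- Tightness of the family `(Q^T(x,·))_{T>0}`. -/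
def TightAt (M : MarkovSemigroup X) (x : X) : Prop :=
  ∀ ε : ℝ, 0 < ε → ∃ K : Set X, IsCompact K ∧
    ∀ T : ℝ, 0 < T → 1 - ε ≤ ((M.Q T x) K).toReal

end TopologicalDefs

end MarkovSemigroup

/-- Topological support of a measure: points all of whose open neighborhoods
have positive mass. -/
def msupport {X : Type*} [MeasurableSpace X] [TopologicalSpace X]
    (μ : MeasureTheory.Measure X) : Set X :=
  {x : X | ∀ U : Set X, IsOpen U → x ∈ U → 0 < μ U}

/-- Total variation distance between two (finite) measures, as the supremum over
Borel sets of the discrepancy of masses. -/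
def tvDist {X : Type*} [MeasurableSpace X] (μ ν : MeasureTheory.Measure X) : ℝ :=
  ⨆ B : {B : Set X // MeasurableSet B}, |(μ B.1).toReal - (ν B.1).toReal|

section MetricDefs

variable {X : Type*} [MeasurableSpace X] [PseudoMetricSpace X]

/-- Bounded Lipschitz real functions. -/
def IsBddLipschitz (ψ : X → ℝ) : Prop :=
  (∃ K : NNReal, LipschitzWith K ψ) ∧ ∃ C : ℝ, ∀ x, |ψ x| ≤ C

/-- The e-property: equicontinuity of `(P_t ψ)_{t ≥ 0}` at every point, for every
bounded Lipschitz `ψ`. -/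
def MarkovSemigroup.EProperty (M : MarkovSemigroup X) : Prop :=
  ∀ ψ : X → ℝ, IsBddLipschitz ψ → ∀ x : X, ∀ ε : ℝ, 0 < ε →
    ∃ δ : ℝ, 0 < δ ∧ ∀ z : X, dist z x < δ → ∀ t : ℝ, 0 ≤ t →
      |M.act t ψ z - M.act t ψ x| < ε

end MetricDefs

theorem abs_intervalIntegral_le_of_abs_le {a b C : ℝ} {f : ℝ → ℝ}
    (h : ∀ s ∈ uIoc a b, |f s| ≤ C) : |∫ s in a..b, f s| ≤ C * |b - a| := by
  simp only [← Real.norm_eq_abs] at h ⊢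
  exact intervalIntegral.norm_integral_le_of_norm_le_const h

theorem abs_indicator_one_le {X : Type*} (B : Set X) (x : X) :
    |B.indicator (1 : X → ℝ) x| ≤ 1 := by
  by_cases h : x ∈ B <;> simp [h]

namespace MarkovSemigroup

section Basic

variable {X : Type*} [MeasurableSpace X] (M : MarkovSemigroup X)

instance isProbabilityMeasure_P (t : ℝ) (x : X) : IsProbabilityMeasure (M.P t x) := M.prob t x

lemma measurable_P (t : ℝ) : Measurable (M.P t) :=
  M.meas.comp (by fun_prop : Measurable fun x => (t, x))

lemma _root_.integrable_of_abs_le {μ : Measure X} [IsFiniteMeasure μ] {f : X → ℝ}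
    (hf : Measurable f) {C : ℝ} (hC : ∀ x, |f x| ≤ C) : Integrable f μ :=
  Integrable.of_bound hf.aestronglyMeasurable C (Eventually.of_forall hC)

lemma _root_.abs_integral_le_of_abs_le {μ : Measure X} [IsProbabilityMeasure μ] {f : X → ℝ}
    {C : ℝ} (hC : ∀ x, |f x| ≤ C) : |∫ x, f x ∂μ| ≤ C := by
  simpa using! norm_integral_le_of_norm_le_const (μ := μ) (f := f) (Eventually.of_forall hC)

lemma _root_.integral_bind_of_abs_le {Y : Type*} [MeasurableSpace Y] {μ : Measure X}
    [IsFiniteMeasure μ] {g : X → Measure Y} (hg : Measurable g)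
    (hp : ∀ x, IsProbabilityMeasure (g x)) {f : Y → ℝ} (hf : Measurable f) {C : ℝ}
    (hC : ∀ y, |f y| ≤ C) : ∫ y, f y ∂(μ.bind g) = ∫ x, ∫ y, f y ∂(g x) ∂μ := by
  let κ : ProbabilityTheory.Kernel X Y := ⟨g, hg⟩
  have : ProbabilityTheory.IsMarkovKernel κ := ⟨hp⟩
  exact ProbabilityTheory.Kernel.integral_comp (κ := ProbabilityTheory.Kernel.const Unit μ)
    (η := κ) (a := ()) (integrable_of_abs_le hf hC)

lemma measurable_act_uncurry {f : X → ℝ} (hf : Measurable f) :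
    Measurable fun p : ℝ × X => M.act p.1 f p.2 := by
  let κ : ProbabilityTheory.Kernel (ℝ × X) X := ⟨fun p => M.P p.1 p.2, M.meas⟩
  exact (StronglyMeasurable.integral_kernel (κ := κ) hf.stronglyMeasurable).measurable

lemma measurable_act (t : ℝ) {f : X → ℝ} (hf : Measurable f) : Measurable (M.act t f) :=
  (M.measurable_act_uncurry hf).comp (by fun_prop : Measurable fun x : X => (t, x))

lemma abs_act_le {f : X → ℝ} {C : ℝ} (hC : ∀ x, |f x| ≤ C) (t : ℝ) (x : X) :
    |M.act t f x| ≤ C := abs_integral_le_of_abs_le hC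

lemma act_mono {f g : X → ℝ} (hf : Measurable f) (hg : Measurable g) {C D : ℝ}
    (hC : ∀ x, |f x| ≤ C) (hD : ∀ x, |g x| ≤ D) (h : ∀ x, f x ≤ g x) (t : ℝ) (x : X) :
    M.act t f x ≤ M.act t g x :=
  integral_mono (integrable_of_abs_le hf hC) (integrable_of_abs_le hg hD) h

lemma act_add_time {f : X → ℝ} (hf : Measurable f) {C : ℝ} (hC : ∀ x, |f x| ≤ C) {t s : ℝ}
    (ht : 0 ≤ t) (hs : 0 ≤ s) (x : X) : M.act (t + s) f x = M.act t (M.act s f) x := by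
  unfold act
  rw [M.semigroup t s ht hs x]
  exact integral_bind_of_abs_le (M.measurable_P s) (fun _ => inferInstance) hf hC

/-- The time average `(1/T) ∫_0^T P_s f(x) ds`. -/
def avg (T : ℝ) (f : X → ℝ) (x : X) : ℝ := T⁻¹ * ∫ s in (0 : ℝ)..T, M.act s f x

lemma intervalIntegrable_act {f : X → ℝ} (hf : Measurable f) {C : ℝ} (hC : ∀ x, |f x| ≤ C)
    (a b : ℝ) (x : X) : IntervalIntegrable (fun s => M.act s f x) volume a b := by
  have hm : Measurable fun s => M.act s f x :=
    (M.measurable_act_uncurry hf).comp (by fun_prop : Measurable fun s : ℝ => (s, x))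
  exact (intervalIntegrable_const (c := C)).mono_fun hm.aestronglyMeasurable
    (Eventually.of_forall fun s => (M.abs_act_le hC s x).trans (le_abs_self C))

lemma integral_avg {f : X → ℝ} (hf : Measurable f) {C : ℝ} (hC : ∀ x, |f x| ≤ C) {T : ℝ}
    (hT : 0 < T) (ν : Measure X) [IsFiniteMeasure ν] :
    ∫ x, M.avg T f x ∂ν = T⁻¹ * ∫ s in (0 : ℝ)..T, ∫ x, M.act s f x ∂ν := by
  unfold avg
  rw [integral_const_mul]
  simp only [intervalIntegral.integral_of_le hT.le]
  rw [integral_integral_swap]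
  exact Integrable.of_bound ((M.measurable_act_uncurry hf).comp measurable_swap).aestronglyMeasurable
    C (Eventually.of_forall fun p => M.abs_act_le hC p.2 p.1)

lemma measurable_avg {f : X → ℝ} (hf : Measurable f) {T : ℝ} (hT : 0 < T) :
    Measurable (M.avg T f) := by
  unfold avg
  simp only [intervalIntegral.integral_of_le hT.le]
  exact ((((M.measurable_act_uncurry hf).comp
    measurable_swap).stronglyMeasurable).integral_prod_right').measurable.const_mul _

lemma avg_le_of_le {f : X → ℝ} (hf : Measurable f) {C : ℝ} (hC : ∀ x, |f x| ≤ C) {T : ℝ}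
    (hT : 0 < T) {x : X} {a : ℝ} (h : ∀ s, 0 ≤ s → M.act s f x ≤ a) : M.avg T f x ≤ a := by
  have := intervalIntegral.integral_mono_on hT.le (M.intervalIntegrable_act hf hC 0 T x)
    (intervalIntegrable_const (c := a)) (fun s hs => h s hs.1)
  rw [intervalIntegral.integral_const, sub_zero, smul_eq_mul] at this
  calc M.avg T f x ≤ T⁻¹ * (T * a) := mul_le_mul_of_nonneg_left this (by positivity)
    _ = a := by field_simp

lemma avg_mono {f g : X → ℝ} (hf : Measurable f) (hg : Measurable g) {C D : ℝ}
    (hC : ∀ x, |f x| ≤ C) (hD : ∀ x, |g x| ≤ D) (h : ∀ x, f x ≤ g x) {T : ℝ} (hT : 0 < T)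
    (x : X) : M.avg T f x ≤ M.avg T g x := by
  refine mul_le_mul_of_nonneg_left ?_ (by positivity)
  exact intervalIntegral.integral_mono_on hT.le (M.intervalIntegrable_act hf hC 0 T x)
    (M.intervalIntegrable_act hg hD 0 T x) fun s _ => M.act_mono hf hg hC hD h s x

lemma abs_avg_sub_avg_le {f : X → ℝ} (hf : Measurable f) {C : ℝ} (hC : ∀ x, |f x| ≤ C) {T : ℝ}
    (hT : 0 < T) {x y : X} {a : ℝ} (h : ∀ s, 0 ≤ s → |M.act s f x - M.act s f y| ≤ a) :
    |M.avg T f x - M.avg T f y| ≤ a := by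
  have key : |∫ s in (0 : ℝ)..T, (M.act s f x - M.act s f y)| ≤ a * |T - 0| :=
    abs_intervalIntegral_le_of_abs_le fun s hs => by
      rw [uIoc_of_le hT.le] at hs
      exact h s hs.1.le
  rw [intervalIntegral.integral_sub (M.intervalIntegrable_act hf hC 0 T x)
    (M.intervalIntegrable_act hf hC 0 T y), sub_zero, abs_of_pos hT] at key
  unfold avg
  rw [← mul_sub, abs_mul, abs_of_pos (inv_pos.2 hT)]
  calc _ ≤ T⁻¹ * (a * T) := mul_le_mul_of_nonneg_left key (by positivity)
    _ = a := by field_simp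

lemma abs_avg_le {f : X → ℝ} {C : ℝ} (hC : ∀ x, |f x| ≤ C) {T : ℝ}
    (hT : 0 < T) (x : X) : |M.avg T f x| ≤ C := by
  have key : |∫ s in (0 : ℝ)..T, M.act s f x| ≤ C * |T - 0| :=
    abs_intervalIntegral_le_of_abs_le fun s _ => M.abs_act_le hC s x
  rw [sub_zero, abs_of_pos hT] at key
  unfold avg
  rw [abs_mul, abs_of_pos (inv_pos.2 hT)]
  calc _ ≤ T⁻¹ * (C * T) := mul_le_mul_of_nonneg_left key (by positivity)
    _ = C := by field_simp

lemma abs_avg_act_sub_avg_le {f : X → ℝ} (hf : Measurable f) {C : ℝ} (hC : ∀ x, |f x| ≤ C)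
    {S T : ℝ} (hS : 0 ≤ S) (hT : 0 < T) (x : X) :
    |M.avg T (M.act S f) x - M.avg T f x| ≤ 2 * C * S / T := by
  have h1 : ∫ s in (0 : ℝ)..T, M.act s (M.act S f) x = ∫ s in (0 + S)..(T + S), M.act s f x := by
    rw [← intervalIntegral.integral_comp_add_right]
    refine intervalIntegral.integral_congr fun s hs => ?_
    rw [uIcc_of_le hT.le] at hs
    exact (M.act_add_time hf hC hs.1 hS x).symm
  have hI := M.intervalIntegrable_act hf hC (x := x)
  have h2 : (∫ s in (0 + S)..(T + S), M.act s f x) - ∫ s in (0 : ℝ)..T, M.act s f x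
      = (∫ s in T..(T + S), M.act s f x) - ∫ s in (0 : ℝ)..S, M.act s f x := by
    rw [zero_add]
    have e1 := intervalIntegral.integral_add_adjacent_intervals (hI 0 S) (hI S (T + S))
    have e2 := intervalIntegral.integral_add_adjacent_intervals (hI 0 T) (hI T (T + S))
    linarith
  have b (u v : ℝ) : |∫ s in u..v, M.act s f x| ≤ C * |v - u| :=
    abs_intervalIntegral_le_of_abs_le fun s _ => M.abs_act_le hC s x
  have b1 := b T (T + S)
  have b2 := b 0 S
  rw [add_sub_cancel_left, abs_of_nonneg hS] at b1
  rw [sub_zero, abs_of_nonneg hS] at b2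
  unfold avg
  rw [← mul_sub, h1, h2, abs_mul, abs_of_pos (inv_pos.2 hT)]
  calc _ ≤ T⁻¹ * (C * S + C * S) :=
        mul_le_mul_of_nonneg_left ((abs_sub _ _).trans (add_le_add b1 b2)) (by positivity)
    _ = 2 * C * S / T := by field_simp; ring

lemma act_avg {f : X → ℝ} (hf : Measurable f) {C : ℝ} (hC : ∀ x, |f x| ≤ C) {S T : ℝ}
    (hS : 0 ≤ S) (hT : 0 < T) (x : X) : M.act S (M.avg T f) x = M.avg T (M.act S f) x := by
  change ∫ y, M.avg T f y ∂(M.P S x) = _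
  rw [M.integral_avg hf hC hT]
  unfold avg
  congr 1
  refine intervalIntegral.integral_congr fun s hs => ?_
  rw [uIcc_of_le hT.le] at hs
  change M.act S (M.act s f) x = M.act s (M.act S f) x
  rw [← M.act_add_time hf hC hS hs.1, ← M.act_add_time hf hC hs.1 hS, add_comm]

lemma isProbabilityMeasure_dual (t : ℝ) (ν : Measure X) [IsProbabilityMeasure ν] :
    IsProbabilityMeasure (M.dual t ν) := by
  refine ⟨?_⟩
  rw [dual, Measure.bind_apply MeasurableSet.univ (M.measurable_P t).aemeasurable]
  simp

lemma measurable_dual (ν : Measure X) [SFinite ν] : Measurable fun t => M.dual t ν := by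
  refine Measure.measurable_of_measurable_coe _ fun B hB => ?_
  simp only [dual, Measure.bind_apply hB (M.measurable_P _).aemeasurable]
  exact Measurable.lintegral_prod_right' (f := fun p : ℝ × X => M.P p.1 p.2 B)
    ((Measure.measurable_coe hB).comp M.meas)

lemma integral_dual {f : X → ℝ} (hf : Measurable f) {C : ℝ} (hC : ∀ x, |f x| ≤ C) (t : ℝ)
    (ν : Measure X) [IsProbabilityMeasure ν] : ∫ x, f x ∂(M.dual t ν) = ∫ x, M.act t f x ∂ν :=
  integral_bind_of_abs_le (M.measurable_P t) (fun _ => inferInstance) hf hC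

lemma isProbabilityMeasure_QM (T : ℝ) (ν : Measure X) [IsProbabilityMeasure ν] :
    IsProbabilityMeasure (M.QM T ν) := by
  unfold QM
  split_ifs with hT
  · infer_instance
  push Not at hT
  have := fun t => M.isProbabilityMeasure_dual t ν
  refine ⟨?_⟩
  rw [Measure.bind_apply MeasurableSet.univ (M.measurable_dual ν).aemeasurable]
  simp only [measure_univ, lintegral_one, Measure.smul_apply, Measure.restrict_apply_univ,
    Real.volume_Ioc, sub_zero, smul_eq_mul]
  rw [← ENNReal.ofReal_mul (by positivity), one_div, inv_mul_cancel₀ hT.ne', ENNReal.ofReal_one]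

instance isProbabilityMeasure_Q (T : ℝ) (x : X) : IsProbabilityMeasure (M.Q T x) :=
  M.isProbabilityMeasure_QM T _

lemma integral_QM {f : X → ℝ} (hf : Measurable f) {C : ℝ} (hC : ∀ x, |f x| ≤ C) {T : ℝ}
    (hT : 0 < T) (ν : Measure X) [IsProbabilityMeasure ν] :
    ∫ x, f x ∂(M.QM T ν) = ∫ x, M.avg T f x ∂ν := by
  rw [M.integral_avg hf hC hT, QM, if_neg hT.not_ge]
  have : IsFiniteMeasure (ENNReal.ofReal (1 / T) • (volume.restrict (Ioc (0 : ℝ) T))) :=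
    Measure.smul_finite _ ENNReal.ofReal_ne_top
  rw [integral_bind_of_abs_le (M.measurable_dual ν) (fun t => M.isProbabilityMeasure_dual t ν) hf hC,
    integral_smul_measure, ENNReal.toReal_ofReal (by positivity), one_div,
    intervalIntegral.integral_of_le hT.le, smul_eq_mul]
  simp only [M.integral_dual hf hC]

lemma integral_Q {f : X → ℝ} (hf : Measurable f) {C : ℝ} (hC : ∀ x, |f x| ≤ C) {T : ℝ}
    (hT : 0 < T) (x : X) : ∫ y, f y ∂(M.Q T x) = M.avg T f x := by
  rw [Q, M.integral_QM hf hC hT, integral_dirac' _ _ (M.measurable_avg hf hT).stronglyMeasurable]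

lemma toReal_Q_apply {B : Set X} (hB : MeasurableSet B) {T : ℝ} (hT : 0 < T) (x : X) :
    (M.Q T x B).toReal = M.avg T (B.indicator 1) x := by
  rw [← M.integral_Q (measurable_one.indicator hB) (abs_indicator_one_le B) hT,
    integral_indicator_one hB]
  rfl

lemma act_indicator {B : Set X} (hB : MeasurableSet B) (t : ℝ) (x : X) :
    M.act t (B.indicator 1) x = (M.P t x B).toReal := integral_indicator_one hB

lemma eventually_lt_avg_of_lt_liminf {B : Set X} (hB : MeasurableSet B) {x : X} {c : ℝ}
    (h : c < liminf (fun T : ℝ => (M.Q T x B).toReal) atTop) :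
    ∀ᶠ T in atTop, c < M.avg T (B.indicator 1) x := by
  have hb : IsBoundedUnder (· ≥ ·) atTop fun T : ℝ => (M.Q T x B).toReal :=
    isBoundedUnder_of ⟨0, fun _ => ENNReal.toReal_nonneg⟩
  filter_upwards [eventually_lt_of_lt_liminf h hb, eventually_gt_atTop 0] with T h1 h2
  rwa [← M.toReal_Q_apply hB h2]

lemma exists_le_act_of_lt_liminf {B : Set X} (hB : MeasurableSet B) {x : X} {c : ℝ}
    (h : c < liminf (fun T : ℝ => (M.Q T x B).toReal) atTop) {S : ℝ} (hS : 0 ≤ S) :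
    ∃ s, S ≤ s ∧ c ≤ (M.P s x B).toReal := by
  by_contra! hc
  obtain ⟨c', hcc, h'⟩ := exists_between h
  have hm : Measurable (B.indicator (1 : X → ℝ)) := measurable_one.indicator hB
  have hlim : Tendsto (fun T : ℝ => 2 * 1 * S / T) atTop (𝓝 0) :=
    tendsto_const_nhds.div_atTop tendsto_id
  obtain ⟨T, hT1, hT0, hT2⟩ := ((M.eventually_lt_avg_of_lt_liminf hB h').and
    ((eventually_gt_atTop 0).and (hlim.eventually (gt_mem_nhds (sub_pos.2 hcc))))).exists
  have h1 := M.abs_avg_act_sub_avg_le hm (abs_indicator_one_le B) hS hT0 x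
  have h2 : M.avg T (M.act S (B.indicator 1)) x ≤ c := by
    refine M.avg_le_of_le (M.measurable_act S hm) (M.abs_act_le (abs_indicator_one_le B) S) hT0
      fun s hs => ?_
    rw [← M.act_add_time hm (abs_indicator_one_le B) hs hS, M.act_indicator hB]
    exact (hc _ (by linarith)).le
  have := (abs_le.1 h1).1
  linarith

end Basic

section Tightness

/-- The supremum of the functions `φ j` over the indices `j` selected by `c`. -/
def selectedSup {X : Type*} (φ : ℕ → X → ℝ) (c : ℕ → Bool) (x : X) : ℝ :=
  ⨆ j, if c j then φ j x else 0

lemma exists_selectedSup_eq {X : Type*} {φ : ℕ → X → ℝ} (h0 : ∀ j x, 0 ≤ φ j x)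
    (hd : ∀ i j x, i ≠ j → φ i x = 0 ∨ φ j x = 0) (x : X) :
    ∃ i, (∀ j, j ≠ i → φ j x = 0) ∧ ∀ c, selectedSup φ c x = if c i then φ i x else 0 := by
  obtain ⟨i, hi⟩ : ∃ i, ∀ j, j ≠ i → φ j x = 0 := by
    by_cases h : ∃ i, φ i x ≠ 0
    · obtain ⟨i, hi⟩ := h
      exact ⟨i, fun j hj => (hd j i x hj).resolve_right hi⟩
    · push Not at h
      exact ⟨0, fun j _ => h j⟩
  refine ⟨i, hi, fun c => ?_⟩
  have hle : ∀ j, (if c j then φ j x else 0) ≤ if c i then φ i x else 0 := by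
    intro j
    by_cases hj : j = i
    · rw [hj]
    · have : 0 ≤ if c i then φ i x else 0 := by split_ifs; exacts [h0 i x, le_rfl]
      simpa [hi j hj] using this
  exact le_antisymm (ciSup_le hle) (le_ciSup (f := fun j => if c j then φ j x else 0)
    ⟨_, forall_mem_range.2 hle⟩ i)

lemma abs_selectedSup_le {X : Type*} {φ : ℕ → X → ℝ} (h0 : ∀ j x, 0 ≤ φ j x)
    (h1 : ∀ j x, φ j x ≤ 1) (hd : ∀ i j x, i ≠ j → φ i x = 0 ∨ φ j x = 0) (c : ℕ → Bool) (x : X) :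
    |selectedSup φ c x| ≤ 1 := by
  obtain ⟨i, -, h⟩ := exists_selectedSup_eq h0 hd x
  rw [h c]
  split_ifs
  · rw [abs_of_nonneg (h0 i x)]
    exact h1 i x
  · simp

lemma continuous_selectedSup {X : Type*} {φ : ℕ → X → ℝ} (h0 : ∀ j x, 0 ≤ φ j x)
    (hd : ∀ i j x, i ≠ j → φ i x = 0 ∨ φ j x = 0) (x : X) :
    Continuous fun c => selectedSup φ c x := by
  obtain ⟨i, -, h⟩ := exists_selectedSup_eq h0 hd x
  simp only [h]
  exact (continuous_of_discreteTopology (f := fun b : Bool => if b then φ i x else 0)).comp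
    (continuous_apply i)

lemma selectedSup_update {X : Type*} {φ : ℕ → X → ℝ} (h0 : ∀ j x, 0 ≤ φ j x)
    (hd : ∀ i j x, i ≠ j → φ i x = 0 ∨ φ j x = 0) (c : ℕ → Bool) (j : ℕ) (x : X) :
    selectedSup φ (Function.update c j true) x - selectedSup φ (Function.update c j false) x
      = φ j x := by
  obtain ⟨i, hi, h⟩ := exists_selectedSup_eq h0 hd x
  rw [h, h]
  by_cases hj : i = j
  · subst hj
    simp
  · simp [Function.update_of_ne hj, hi j (Ne.symm hj)]

lemma lipschitzWith_selectedSup {X : Type*} [PseudoMetricSpace X] {φ : ℕ → X → ℝ} {K : NNReal}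
    (hK : ∀ j, LipschitzWith K (φ j)) (h1 : ∀ j x, φ j x ≤ 1) (c : ℕ → Bool) :
    LipschitzWith K (selectedSup φ c) := by
  refine LipschitzWith.of_le_add_mul K fun x y => ciSup_le fun j => ?_
  have hb : BddAbove (range fun j => if c j then φ j y else 0) := by
    refine ⟨1, forall_mem_range.2 fun i => ?_⟩
    split_ifs
    exacts [h1 i y, zero_le_one]
  refine le_trans ?_ (add_le_add_left (le_ciSup hb j) _)
  have hnn : 0 ≤ K * dist x y := by positivity
  split_ifs
  · exact (hK j).le_add_mul x y
  · linarith

lemma measurable_of_lipschitzWith {X : Type*} [PseudoMetricSpace X] [MeasurableSpace X]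
    [BorelSpace X] {f : X → ℝ} {K : NNReal} (h : LipschitzWith K f) : Measurable f :=
  h.continuous.measurable

lemma avg_finsetSum_le_one {X : Type*} [MeasurableSpace X] {M : MarkovSemigroup X}
    {φ : ℕ → X → ℝ} (hm : ∀ j, Measurable (φ j))
    (h0 : ∀ j x, 0 ≤ φ j x) (h1 : ∀ j x, φ j x ≤ 1)
    (hd : ∀ i j x, i ≠ j → φ i x = 0 ∨ φ j x = 0) (s : Finset ℕ) {T : ℝ} (hT : 0 < T) (x : X) :
    ∑ j ∈ s, M.avg T (φ j) x ≤ 1 := by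
  have hb (j : ℕ) (y : X) : |φ j y| ≤ 1 := by rw [abs_of_nonneg (h0 j y)]; exact h1 j y
  have hφint (j : ℕ) : Integrable (φ j) (M.Q T x) := integrable_of_abs_le (hm j) (hb j)
  simp only [← M.integral_Q (hm _) (hb _) hT]
  rw [← integral_finsetSum _ fun j _ => hφint j]
  refine (integral_mono (integrable_finsetSum _ fun j _ => hφint j) (integrable_const 1)
    fun y => ?_).trans (by simp)
  obtain ⟨i, hi, -⟩ := exists_selectedSup_eq h0 hd y
  calc ∑ j ∈ s, φ j y ≤ ∑ j ∈ s, if j = i then φ i y else 0 := by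
        refine Finset.sum_le_sum fun j _ => ?_
        split_ifs with h
        · rw [h]
        · exact (hi j h).le
    _ ≤ 1 := by
        rw [Finset.sum_ite_eq']
        split_ifs
        exacts [h1 i y, zero_le_one]

variable {X : Type*} [PseudoMetricSpace X] [MeasurableSpace X] [BorelSpace X]

/-- The e-property holds uniformly along the tail of any sequence of uniformly Lipschitz functions
with disjoint supports. -/
lemma EProperty.exists_uniform {M : MarkovSemigroup X} (hE : M.EProperty) {φ : ℕ → X → ℝ}
    {K : NNReal} (hK : ∀ j, LipschitzWith K (φ j)) (h0 : ∀ j x, 0 ≤ φ j x)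
    (h1 : ∀ j x, φ j x ≤ 1) (hd : ∀ i j x, i ≠ j → φ i x = 0 ∨ φ j x = 0) (z : X) {ε : ℝ}
    (hε : 0 < ε) : ∃ δ > 0, ∃ N, ∀ j ≥ N, ∀ y, dist y z < δ → ∀ t, 0 ≤ t →
      |M.act t (φ j) y - M.act t (φ j) z| ≤ 2 * ε := by
  have hlip := lipschitzWith_selectedSup hK h1
  have hm (c : ℕ → Bool) : Measurable (selectedSup φ c) := measurable_of_lipschitzWith (hlip c)
  have hb := abs_selectedSup_le h0 h1 hd
  have hcont (t : ℝ) (y : X) : Continuous fun c => M.act t (selectedSup φ c) y :=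
    continuous_of_dominated (bound := fun _ => 1) (fun c => (hm c).aestronglyMeasurable)
      (fun c => Eventually.of_forall (hb c)) (integrable_const _)
      (Eventually.of_forall (continuous_selectedSup h0 hd))
  let F : ℕ → Set (ℕ → Bool) := fun m => {c | ∀ y, dist y z < 1 / ((m : ℝ) + 1) → ∀ t, 0 ≤ t →
    |M.act t (selectedSup φ c) y - M.act t (selectedSup φ c) z| ≤ ε}
  have hF (m : ℕ) : IsClosed (F m) := by
    simp only [F, ofPred_forall]
    exact isClosed_iInter fun y => isClosed_iInter fun _ => isClosed_iInter fun t =>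
      isClosed_iInter fun _ => isClosed_le ((hcont t y).sub (hcont t z)).abs continuous_const
  have hU : ⋃ m, F m = univ := by
    refine eq_univ_of_forall fun c => mem_iUnion.2 ?_
    obtain ⟨δ, hδ, h⟩ := hE _ ⟨⟨K, hlip c⟩, 1, hb c⟩ z ε hε
    obtain ⟨m, hm⟩ := exists_nat_one_div_lt hδ
    exact ⟨m, fun y hy t ht => (h y (hy.trans hm) t ht).le⟩
  obtain ⟨m, c, hc⟩ := nonempty_interior_of_iUnion_of_closed hF hU
  have hup (b : Bool) : ∀ᶠ j in atTop, Function.update c j b ∈ F m := by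
    have : Tendsto (fun j => Function.update c j b) atTop (𝓝 c) := by
      refine tendsto_pi_nhds.2 fun i => tendsto_const_nhds.congr' ?_
      filter_upwards [eventually_gt_atTop i] with j hj
      rw [Function.update_of_ne hj.ne]
    exact this.eventually (mem_interior_iff_mem_nhds.1 hc)
  obtain ⟨N, hN⟩ := eventually_atTop.1 ((hup true).and (hup false))
  refine ⟨1 / ((m : ℝ) + 1), by positivity, N, fun j hj y hy t ht => ?_⟩
  have hsub (w : X) : M.act t (φ j) w = M.act t (selectedSup φ (Function.update c j true)) w
      - M.act t (selectedSup φ (Function.update c j false)) w := by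
    unfold act
    rw [← integral_sub (integrable_of_abs_le (hm _) (hb _)) (integrable_of_abs_le (hm _) (hb _))]
    simp only [selectedSup_update h0 hd]
  rw [hsub, hsub]
  have ha := abs_le.1 ((hN j hj).1 y hy t ht)
  have hb := abs_le.1 ((hN j hj).2 y hy t ht)
  exact abs_le.2 ⟨by linarith [ha.1, hb.2], by linarith [ha.2, hb.1]⟩

/-- A sequence of uniformly Lipschitz functions with disjoint supports cannot be charged uniformly
by the laws started from a point all of whose neighborhoods are visited a positive fraction of
time. -/
lemma EProperty.not_forall_exists_le_act {M : MarkovSemigroup X} (hE : M.EProperty) {z : X}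
    (hz : ∀ δ > 0, ∃ c > 0, ∀ᶠ T in atTop, c < M.avg T ((ball z δ).indicator 1) z)
    {φ : ℕ → X → ℝ} {K : NNReal} (hK : ∀ j, LipschitzWith K (φ j)) (h0 : ∀ j x, 0 ≤ φ j x)
    (h1 : ∀ j x, φ j x ≤ 1) (hd : ∀ i j x, i ≠ j → φ i x = 0 ∨ φ j x = 0) {a : ℝ} (ha : 0 < a) :
    ¬ ∀ j, ∃ t, 0 ≤ t ∧ a ≤ M.act t (φ j) z := by
  intro H
  choose t ht hat using H
  obtain ⟨δ, hδ, N, hN⟩ := hE.exists_uniform hK h0 h1 hd z (ε := a / 4) (by positivity)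
  obtain ⟨c, hc, hcz⟩ := hz δ hδ
  have hm (j : ℕ) : Measurable (φ j) := measurable_of_lipschitzWith (hK j)
  have hb (j : ℕ) (y : X) : |φ j y| ≤ 1 := by rw [abs_of_nonneg (h0 j y)]; exact h1 j y
  have hlow : ∀ j ≥ N, ∀ᶠ T in atTop, a * c / 4 ≤ M.avg T (φ j) z := by
    intro j hj
    have hlim : Tendsto (fun T : ℝ => 2 * 1 * t j / T) atTop (𝓝 0) :=
      tendsto_const_nhds.div_atTop tendsto_id
    filter_upwards [hcz, eventually_gt_atTop 0,
      hlim.eventually (gt_mem_nhds (by positivity : 0 < a * c / 4))] with T hT1 hT0 hT2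
    have e1 := (abs_le.1 (M.abs_avg_act_sub_avg_le (hm j) (hb j) (ht j) hT0 z)).2
    have e2 : M.avg T (fun y => a / 2 * (ball z δ).indicator 1 y) z
        ≤ M.avg T (M.act (t j) (φ j)) z := by
      refine M.avg_mono (C := a / 2) (D := 1)
        ((measurable_one.indicator measurableSet_ball).const_mul _) (M.measurable_act _ (hm j))
        (fun y => ?_) (M.abs_act_le (hb j) _) (fun y => ?_) hT0 z
      · rw [abs_mul, abs_of_pos (half_pos ha)]
        exact mul_le_of_le_one_right (half_pos ha).le (abs_indicator_one_le _ y)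
      · by_cases hy : y ∈ ball z δ
        · have := (abs_le.1 (hN j hj y hy (t j) (ht j))).1
          simp only [indicator_of_mem hy, Pi.one_apply]
          linarith [hat j]
        · rw [indicator_of_notMem hy, mul_zero]
          exact integral_nonneg (h0 j)
    have e3 : M.avg T (fun y => a / 2 * (ball z δ).indicator 1 y) z
        = a / 2 * M.avg T ((ball z δ).indicator 1) z := by
      simp only [avg, act, integral_const_mul, intervalIntegral.integral_const_mul]
      ring
    have e4 : a / 2 * c ≤ a / 2 * M.avg T ((ball z δ).indicator 1) z := by gcongr
    linarith
  obtain ⟨J, hJ⟩ := exists_nat_gt (1 / (a * c / 4))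
  obtain ⟨T, hT, hT0⟩ := (((Finset.eventually_all (Finset.Ico N (N + J))).2 fun j hj =>
    hlow j (Finset.mem_Ico.1 hj).1).and (eventually_gt_atTop (0 : ℝ))).exists
  have h2 := Finset.card_nsmul_le_sum _ _ _ hT
  have h3 := avg_finsetSum_le_one (M := M) hm h0 h1 hd (Finset.Ico N (N + J)) hT0 z
  rw [Nat.card_Ico, add_tsub_cancel_left, nsmul_eq_mul] at h2
  rw [div_lt_iff₀ (by positivity)] at hJ
  linarith

/-- Uniform smallness along a decreasing sequence of uniformly Lipschitz functions. -/
lemma EProperty.exists_forall_act_lt {M : MarkovSemigroup X} (hE : M.EProperty) {z : X}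
    (hz : ∀ δ > 0, ∃ c > 0, ∀ᶠ T in atTop, c < M.avg T ((ball z δ).indicator 1) z)
    {h : ℕ → X → ℝ} {K : NNReal} (hK : ∀ j, LipschitzWith K (h j)) (h0 : ∀ j x, 0 ≤ h j x)
    (h1 : ∀ j x, h j x ≤ 1) (hanti : Antitone h) (hlim : ∀ x, Tendsto (h · x) atTop (𝓝 0))
    {a : ℝ} (ha : 0 < a) : ∃ k, ∀ t, 0 ≤ t → M.act t (h k) z < a := by
  by_contra! H
  choose s hs has using H
  have hm (j : ℕ) : Measurable (h j) := measurable_of_lipschitzWith (hK j)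
  have hb (j : ℕ) (y : X) : |h j y| ≤ 1 := by rw [abs_of_nonneg (h0 j y)]; exact h1 j y
  have hnext (k : ℕ) : ∃ k', k < k' ∧ M.act (s k) (h k') z ≤ a ^ 2 / 8 := by
    have : Tendsto (fun j => M.act (s k) (h j) z) atTop (𝓝 (∫ _, 0 ∂(M.P (s k) z))) :=
      tendsto_integral_of_dominated_convergence (fun _ => 1)
        (fun j => (hm j).aestronglyMeasurable) (integrable_const _)
        (fun j => Eventually.of_forall (hb j)) (Eventually.of_forall hlim)
    rw [integral_zero] at this
    obtain ⟨k', h1, h2⟩ := ((eventually_gt_atTop k).and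
      (this.eventually (ge_mem_nhds (by positivity : 0 < a ^ 2 / 8)))).exists
    exact ⟨k', h1, h2⟩
  choose nxt hlt hnxt using hnext
  let κ : ℕ → ℕ := fun j => nxt^[j] 0
  have hκs (j : ℕ) : κ (j + 1) = nxt (κ j) := Function.iterate_succ_apply' _ _ _
  have hκ : StrictMono κ := strictMono_nat_of_lt_succ fun j => by rw [hκs]; exact hlt _
  let φ : ℕ → X → ℝ := fun j x => max (h (κ j) x - a / 2 - 2 / a * h (κ (j + 1)) x) 0
  have hle (j : ℕ) (x : X) : h (κ j) x - a / 2 - 2 / a * h (κ (j + 1)) x ≤ 1 := by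
    have e1 := h1 (κ j) x
    have e2 : 0 ≤ 2 / a * h (κ (j + 1)) x := mul_nonneg (by positivity) (h0 _ _)
    linarith
  have hφ0 (j : ℕ) (x : X) : 0 ≤ φ j x := le_max_right _ _
  have hφ1 (j : ℕ) (x : X) : φ j x ≤ 1 := max_le (hle j x) zero_le_one
  have hlt' : ∀ i j x, i < j → φ i x = 0 ∨ φ j x = 0 := by
    intro i j x hij
    by_contra! hc
    have p (k : ℕ) (hk : φ k x ≠ 0) : 0 < h (κ k) x - a / 2 - 2 / a * h (κ (k + 1)) x := by
      by_contra! hneg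
      exact hk (max_eq_right hneg)
    have pi := p i hc.1
    have pj := p j hc.2
    have e1 : h (κ j) x ≤ h (κ (i + 1)) x := hanti (hκ.monotone hij) x
    have e2 : 0 ≤ 2 / a * h (κ (j + 1)) x := mul_nonneg (by positivity) (h0 _ _)
    have e3 : 2 / a * (a / 2) ≤ 2 / a * h (κ (i + 1)) x := by gcongr; linarith
    have e4 : 2 / a * (a / 2) = 1 := by field_simp
    linarith [h1 (κ i) x]
  have hd : ∀ i j x, i ≠ j → φ i x = 0 ∨ φ j x = 0 := by
    intro i j x hij
    rcases hij.lt_or_gt with hl | hl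
    exacts [hlt' i j x hl, (hlt' j i x hl).symm]
  let L : NNReal := K + Real.toNNReal (2 / a) * K
  have hL (j : ℕ) : LipschitzWith L (φ j) := by
    have e1 : LipschitzWith (Real.toNNReal (2 / a) * K) fun x => 2 / a * h (κ (j + 1)) x := by
      refine LipschitzWith.of_dist_le_mul fun x y => ?_
      rw [Real.dist_eq, ← mul_sub, abs_mul, abs_of_pos (by positivity), NNReal.coe_mul,
        Real.coe_toNNReal _ (by positivity), mul_assoc]
      exact mul_le_mul_of_nonneg_left ((hK _).dist_le_mul x y) (by positivity)
    have e2 : LipschitzWith (K + 0) fun x => h (κ j) x - a / 2 :=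
      (hK _).sub (LipschitzWith.const _)
    rw [add_zero] at e2
    exact (e2.sub e1).max_const 0
  refine hE.not_forall_exists_le_act hz hL hφ0 hφ1 hd (a := a / 4) (by positivity) fun j =>
    ⟨s (κ j), hs _, ?_⟩
  have hi (k : ℕ) : Integrable (h k) (M.P (s (κ j)) z) := integrable_of_abs_le (hm k) (hb k)
  have e : ∫ x, (h (κ j) x - a / 2 - 2 / a * h (κ (j + 1)) x) ∂(M.P (s (κ j)) z)
      ≤ M.act (s (κ j)) (φ j) z := by
    refine integral_mono (((hi _).sub (integrable_const _)).sub ((hi _).const_mul _))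
      (integrable_of_abs_le (measurable_of_lipschitzWith (hL j)) (C := 1) fun y => ?_)
      fun x => le_max_left _ _
    rw [abs_of_nonneg (hφ0 j y)]
    exact hφ1 j y
  have hi2 : Integrable (fun x => h (κ j) x - a / 2) (M.P (s (κ j)) z) :=
    (hi _).sub (integrable_const _)
  rw [integral_sub hi2 ((hi _).const_mul _), integral_sub (hi _) (integrable_const _),
    integral_const_mul] at e
  simp only [integral_const, probReal_univ, one_smul] at e
  have e1 : ∫ x, h (κ (j + 1)) x ∂(M.P (s (κ j)) z) ≤ a ^ 2 / 8 := by
    rw [hκs]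
    exact hnxt (κ j)
  have e2 : a ≤ ∫ x, h (κ j) x ∂(M.P (s (κ j)) z) := has (κ j)
  have e3 : 2 / a * ∫ x, h (κ (j + 1)) x ∂(M.P (s (κ j)) z) ≤ 2 / a * (a ^ 2 / 8) := by gcongr
  have e4 : 2 / a * (a ^ 2 / 8) = a / 4 := by field_simp; ring
  linarith

end Tightness

section Invariant

/-- A family of measures on a complete metric space which is uniformly concentrated, at every scale,
near finite sets is tight. -/
lemma _root_.isTightMeasureSet_of_forall_exists_finite {X : Type*} [PseudoMetricSpace X]
    [CompleteSpace X] [MeasurableSpace X] {S : Set (Measure X)}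
    (h : ∀ r > 0, ∀ η : ENNReal, 0 < η → ∃ t : Set X, t.Finite ∧ t.Nonempty ∧
      ∀ μ ∈ S, μ {x | r ≤ infDist x t} ≤ η) : IsTightMeasureSet S := by
  rw [isTightMeasureSet_iff_exists_isCompact_measure_compl_le]
  intro ε hε
  obtain ⟨η, hη, hsum⟩ := ENNReal.exists_pos_sum_of_countable' hε.ne' ℕ
  choose t ht hne htμ using fun m : ℕ => h (1 / ((m : ℝ) + 1)) (by positivity) (η m) (hη m)
  refine ⟨⋂ m : ℕ, {x | infDist x (t m) ≤ 1 / ((m : ℝ) + 1)}, ?_, fun μ hμ => ?_⟩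
  · refine isCompact_iff_totallyBounded_isComplete.2 ⟨totallyBounded_iff.2 fun ε hε => ?_,
      (isClosed_iInter fun m => isClosed_le (continuous_infDist_pt _) continuous_const).isComplete⟩
    obtain ⟨m, hm⟩ := exists_nat_one_div_lt hε
    refine ⟨t m, ht m, fun x hx => ?_⟩
    obtain ⟨y, hy, hxy⟩ := (infDist_lt_iff (hne m)).1 ((mem_iInter.1 hx m).trans_lt hm)
    exact mem_iUnion₂.2 ⟨y, hy, hxy⟩
  · have hsub (m : ℕ) : {x | infDist x (t m) ≤ 1 / ((m : ℝ) + 1)}ᶜ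
        ⊆ {x | 1 / ((m : ℝ) + 1) ≤ infDist x (t m)} :=
      fun x hx => (lt_of_not_ge (show ¬ infDist x (t m) ≤ _ from hx)).le
    rw [compl_iInter]
    calc μ (⋃ m : ℕ, {x | infDist x (t m) ≤ 1 / ((m : ℝ) + 1)}ᶜ)
        ≤ ∑' m : ℕ, μ {x | infDist x (t m) ≤ 1 / ((m : ℝ) + 1)}ᶜ := measure_iUnion_le _
      _ ≤ ∑' m, η m := ENNReal.tsum_le_tsum fun m =>
          (measure_mono (hsub m)).trans (htμ m μ hμ)
      _ ≤ ε := hsum.le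

variable {X : Type*} [MetricSpace X] [SecondCountableTopology X] [MeasurableSpace X]
  [BorelSpace X] {M : MarkovSemigroup X} {z : X}

lemma EProperty.exists_finite_forall_Q_le (hE : M.EProperty)
    (hz : ∀ δ > 0, ∃ c > 0, ∀ᶠ T in atTop, c < M.avg T ((ball z δ).indicator 1) z)
    {r : ℝ} (hr : 0 < r) {η : ENNReal} (hη : 0 < η) :
    ∃ t : Set X, t.Finite ∧ t.Nonempty ∧ ∀ T > 0, M.Q T z {x | r ≤ infDist x t} ≤ η := by
  have : Nonempty X := ⟨z⟩
  obtain ⟨d, hd⟩ := TopologicalSpace.exists_dense_seq X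
  obtain ⟨a, ha0, ha⟩ : ∃ a : ℝ, 0 < a ∧ ENNReal.ofReal a ≤ η := by
    obtain ⟨b, hb0, hb⟩ := ENNReal.lt_iff_exists_nnreal_btwn.1 hη
    exact ⟨b, by exact_mod_cast hb0, by simpa using hb.le⟩
  have hne (k : ℕ) : (d '' Iic k).Nonempty := ⟨d 0, 0, by simp, rfl⟩
  let h : ℕ → X → ℝ := fun k x => min 1 (r⁻¹ * infDist x (d '' Iic k))
  have h0 (k : ℕ) (x : X) : 0 ≤ h k x :=
    le_min zero_le_one (mul_nonneg (by positivity) infDist_nonneg)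
  have h1 (k : ℕ) (x : X) : h k x ≤ 1 := min_le_left _ _
  have hK (k : ℕ) : LipschitzWith (Real.toNNReal r⁻¹) (h k) := by
    refine LipschitzWith.const_min (LipschitzWith.of_dist_le_mul fun x y => ?_) 1
    rw [Real.dist_eq, ← mul_sub, abs_mul, abs_of_pos (by positivity),
      Real.coe_toNNReal _ (by positivity)]
    exact mul_le_mul_of_nonneg_left
      (by simpa [Real.dist_eq] using (lipschitz_infDist_pt _).dist_le_mul x y) (by positivity)
  have hanti : Antitone h := fun i j hij x => by
    refine min_le_min_left _ (mul_le_mul_of_nonneg_left ?_ (by positivity))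
    exact infDist_le_infDist_of_subset (image_mono (Iic_subset_Iic.2 hij)) (hne i)
  have hlim (x : X) : Tendsto (h · x) atTop (𝓝 0) := by
    refine tendsto_order.2 ⟨fun b hb => Eventually.of_forall fun k => hb.trans_le (h0 k x),
      fun b hb => ?_⟩
    obtain ⟨k, hk⟩ := hd.exists_dist_lt x (mul_pos hr hb)
    filter_upwards [eventually_ge_atTop k] with j hj
    calc h j x ≤ r⁻¹ * infDist x (d '' Iic j) := min_le_right _ _
      _ ≤ r⁻¹ * dist x (d k) := by
          gcongr
          exact infDist_le_dist_of_mem (mem_image_of_mem d hj)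
      _ < r⁻¹ * (r * b) := by gcongr
      _ = b := by field_simp
  obtain ⟨k, hk⟩ := hE.exists_forall_act_lt hz hK h0 h1 hanti hlim ha0
  refine ⟨d '' Iic k, (finite_Iic k).image d, hne k, fun T hT => ?_⟩
  have hB : MeasurableSet {x | r ≤ infDist x (d '' Iic k)} :=
    (isClosed_le continuous_const (continuous_infDist_pt _)).measurableSet
  have hfin := M.isProbabilityMeasure_Q T z
  rw [← ENNReal.ofReal_toReal (measure_ne_top (M.Q T z) _), M.toReal_Q_apply hB hT]
  refine (ENNReal.ofReal_le_ofReal ?_).trans ha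
  refine M.avg_le_of_le (measurable_one.indicator hB) (abs_indicator_one_le _) hT fun s hs =>
    (M.act_mono (measurable_one.indicator hB) (hK k).continuous.measurable
      (abs_indicator_one_le _) (D := 1) (fun x => ?_) (fun x => ?_) s z).trans (hk s hs).le
  · rw [abs_of_nonneg (h0 k x)]
    exact h1 k x
  · refine indicator_le' (fun x hx => ?_) (fun x _ => h0 k x) x
    refine le_min le_rfl ?_
    rw [Pi.one_apply, ← inv_mul_cancel₀ hr.ne']
    exact mul_le_mul_of_nonneg_left hx (by positivity)

lemma _root_.BoundedContinuousFunction.isBddContinuous {X : Type*} [TopologicalSpace X]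
    (f : BoundedContinuousFunction X ℝ) : IsBddContinuous f :=
  ⟨f.continuous, ‖f‖, f.norm_coe_le_norm⟩

/-- Existence of an invariant probability measure. -/
lemma EProperty.exists_invariant [CompleteSpace X] (hE : M.EProperty) (hF : M.Feller)
    (hz : ∀ δ > 0, ∃ c > 0, ∀ᶠ T in atTop, c < M.avg T ((ball z δ).indicator 1) z) :
    ∃ μ : Measure X, IsProbabilityMeasure μ ∧ M.Invariant μ := by
  let q : ℝ → ProbabilityMeasure X := fun T => ⟨M.Q T z, M.isProbabilityMeasure_Q T z⟩
  have htight : IsTightMeasureSet {((μ : ProbabilityMeasure X) : Measure X) | μ ∈ q '' Ioi 0} := by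
    refine isTightMeasureSet_of_forall_exists_finite fun r hr η hη => ?_
    obtain ⟨t, ht, hne, htQ⟩ := hE.exists_finite_forall_Q_le hz hr hη
    refine ⟨t, ht, hne, ?_⟩
    rintro _ ⟨_, ⟨T, hT, rfl⟩, rfl⟩
    exact htQ T hT
  let U : Ultrafilter ℝ := Ultrafilter.of atTop
  have hU : (U : Filter ℝ) ≤ atTop := Ultrafilter.of_le _
  obtain ⟨μ, -, hμ⟩ := (isCompact_closure_of_isTightMeasureSet htight).ultrafilter_le_nhds (U.map q)
    (le_principal_iff.2 (mem_map.2 (mem_of_superset (hU (Ioi_mem_atTop 0)) fun T hT =>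
      subset_closure (mem_image_of_mem q hT))))
  have hlim : Tendsto q U (𝓝 μ) := hμ
  rw [ProbabilityMeasure.tendsto_iff_forall_integral_tendsto] at hlim
  refine ⟨μ, inferInstance, fun t ht => ?_⟩
  have := M.isProbabilityMeasure_dual t (μ : Measure X)
  refine ext_of_forall_integral_eq_of_IsFiniteMeasure fun f => ?_
  have hf : Measurable f := f.continuous.measurable
  have hfb : ∀ x, |f x| ≤ ‖f‖ := f.norm_coe_le_norm
  rw [M.integral_dual hf hfb]
  have l1 : Tendsto (fun T => M.avg T f z) U (𝓝 (∫ x, f x ∂(μ : Measure X))) := by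
    refine (hlim f).congr' ?_
    filter_upwards [hU (Ioi_mem_atTop 0)] with T hT using M.integral_Q hf hfb hT z
  have l2 : Tendsto (fun T => M.avg T (M.act t f) z) U
      (𝓝 (∫ x, M.act t f x ∂(μ : Measure X))) := by
    refine (hlim (BoundedContinuousFunction.ofNormedAddCommGroup (M.act t f)
      (hF t ht f f.isBddContinuous) ‖f‖ (M.abs_act_le hfb t))).congr' ?_
    filter_upwards [hU (Ioi_mem_atTop 0)] with T hT using
      M.integral_Q (M.measurable_act t hf) (M.abs_act_le hfb t) hT z
  have l3 : Tendsto (fun T => M.avg T (M.act t f) z - M.avg T f z) U (𝓝 0) := by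
    have l4 : Tendsto (fun T : ℝ => 2 * ‖f‖ * t / T) U (𝓝 0) :=
      (tendsto_const_nhds.div_atTop tendsto_id).mono_left hU
    refine squeeze_zero_norm' ?_ l4
    filter_upwards [hU (Ioi_mem_atTop 0)] with T hT using
      M.abs_avg_act_sub_avg_le hf hfb ht hT z
  exact sub_eq_zero.1 (tendsto_nhds_unique (l2.sub l1) l3)

end Invariant

section Subharmonic

variable {X : Type*} [MeasurableSpace X] {M : MarkovSemigroup X}

lemma tendsto_act_of_abs_le {f : ℕ → X → ℝ} {g : X → ℝ} (hf : ∀ n, Measurable (f n)) {C : ℝ}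
    (hC : ∀ n x, |f n x| ≤ C) (hlim : ∀ x, Tendsto (f · x) atTop (𝓝 (g x))) (s : ℝ) (x : X) :
    Tendsto (fun n => M.act s (f n) x) atTop (𝓝 (M.act s g x)) :=
  tendsto_integral_of_dominated_convergence (fun _ => C) (fun n => (hf n).aestronglyMeasurable)
    (integrable_const _) (fun n => Eventually.of_forall (hC n)) (Eventually.of_forall hlim)

lemma sq_add_act_sub_sq_le {u : X → ℝ} (hm : Measurable u) {C : ℝ} (h0 : ∀ y, 0 ≤ u y)
    (hC : ∀ y, |u y| ≤ C) {t : ℝ} {y : X} (hu : u y ≤ M.act t u y) :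
    u y ^ 2 + M.act t (fun w => (u w - u y) ^ 2) y ≤ M.act t (u ^ 2) y := by
  have hi : Integrable u (M.P t y) := integrable_of_abs_le hm hC
  have hi2 : Integrable (u ^ 2) (M.P t y) := by
    refine integrable_of_abs_le (hm.pow_const 2) (C := C ^ 2) fun w => ?_
    rw [Pi.pow_apply, abs_pow]
    gcongr
    exact hC w
  have e : M.act t (fun w => (u w - u y) ^ 2) y
      = M.act t (u ^ 2) y - 2 * u y * M.act t u y + u y ^ 2 := by
    have e1 : (fun w => (u w - u y) ^ 2) = fun w => (u ^ 2) w - 2 * u y * u w + u y ^ 2 := by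
      funext w
      rw [Pi.pow_apply]
      ring
    have hi3 : Integrable (fun w => (u ^ 2) w - 2 * u y * u w) (M.P t y) :=
      hi2.sub (hi.const_mul _)
    unfold act
    rw [e1, integral_add hi3 (integrable_const _), integral_sub hi2 (hi.const_mul _),
      integral_const_mul, integral_const, probReal_univ, one_smul]
  rw [e]
  nlinarith [mul_le_mul_of_nonneg_left hu (h0 y)]

/-- A bounded subharmonic function which is small on a set reached from every bounded set with
uniformly positive probability is small at every point whose orbit is concentrated on bounded
sets. -/
lemma le_two_mul_of_forall_le_act [Bornology X] {u : X → ℝ} (hm : Measurable u) {C : ℝ}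
    (h0 : ∀ y, 0 ≤ u y) (hC : ∀ y, u y ≤ C) (hu : ∀ s, 0 ≤ s → ∀ y, u y ≤ M.act s u y)
    {B : Set X} (hB : MeasurableSet B) {ε : ℝ} (hε : 0 < ε) (huB : ∀ y ∈ B, u y ≤ ε) {x : X}
    (hlow : ∀ D, Bornology.IsBounded D → ∃ c > 0, ∀ y ∈ D, ∃ t, 0 ≤ t ∧ c ≤ (M.P t y B).toReal)
    (hconc : ∀ η > 0, ∃ D, Bornology.IsBounded D ∧ MeasurableSet D ∧
      ∀ S, 0 ≤ S → ∃ s, S ≤ s ∧ 1 - η ≤ (M.P s x D).toReal) :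
    u x ≤ 2 * ε := by
  have hC0 : 0 ≤ C := (h0 x).trans (hC x)
  have hb (y : X) : |u y| ≤ C := by rw [abs_of_nonneg (h0 y)]; exact hC y
  have hm2 : Measurable (u ^ 2) := hm.pow_const 2
  have hb2 (y : X) : |(u ^ 2) y| ≤ C ^ 2 := by
    rw [Pi.pow_apply, abs_pow]
    gcongr
    exact hb y
  have hsq {t : ℝ} (ht : 0 ≤ t) (y : X) : (u ^ 2) y ≤ M.act t (u ^ 2) y :=
    (le_add_of_nonneg_right (integral_nonneg fun w => sq_nonneg _)).trans
      (sq_add_act_sub_sq_le hm h0 hb (hu t ht y))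
  have hmono {s t : ℝ} (hs : 0 ≤ s) (hst : s ≤ t) (y : X) :
      M.act s (u ^ 2) y ≤ M.act t (u ^ 2) y := by
    rw [← add_sub_cancel s t, M.act_add_time hm2 hb2 hs (sub_nonneg.2 hst)]
    exact M.act_mono hm2 (M.measurable_act _ hm2) hb2 (M.abs_act_le hb2 _)
      (hsq (sub_nonneg.2 hst)) s y
  let G : X → ℝ := fun y => ⨆ n : ℕ, M.act n (u ^ 2) y
  have hbdd (y : X) : BddAbove (range fun n : ℕ => M.act n (u ^ 2) y) :=
    ⟨C ^ 2, forall_mem_range.2 fun n => (abs_le.1 (M.abs_act_le hb2 n y)).2⟩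
  have hG {t : ℝ} (ht : 0 ≤ t) (y : X) : M.act t (u ^ 2) y ≤ G y :=
    (hmono ht (Nat.le_ceil t) y).trans (le_ciSup (hbdd y) _)
  have hGlim (y : X) : Tendsto (fun n : ℕ => M.act n (u ^ 2) y) atTop (𝓝 (G y)) :=
    tendsto_atTop_ciSup (fun i j hij => hmono i.cast_nonneg (by exact_mod_cast hij) y) (hbdd y)
  have hGm : Measurable G := Measurable.iSup fun n => M.measurable_act _ hm2
  have hGb (y : X) : |G y| ≤ C ^ 2 :=
    le_of_tendsto (hGlim y).abs (Eventually.of_forall fun n => M.abs_act_le hb2 n y)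
  have hGx {s : ℝ} (hs : 0 ≤ s) : M.act s G x ≤ G x := by
    refine le_of_tendsto (tendsto_act_of_abs_le (fun n => M.measurable_act _ hm2)
      (fun n y => M.abs_act_le hb2 _ y) hGlim s x) (Eventually.of_forall fun n => ?_)
    rw [← M.act_add_time hm2 hb2 hs n.cast_nonneg]
    exact hG (by positivity) x
  refine le_of_forall_pos_le_add fun δ hδ => ?_
  obtain ⟨η, hη, hηδ⟩ : ∃ η : ℝ, 0 < η ∧ C * η + C * η ≤ δ := by
    refine ⟨δ / (2 * (C + 1)), by positivity, ?_⟩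
    rw [← two_mul, ← mul_assoc, mul_div_assoc', div_le_iff₀ (by positivity)]
    nlinarith
  obtain ⟨D, hDb, hD, hDx⟩ := hconc η hη
  obtain ⟨c, hc, hcD⟩ := hlow D hDb
  let E : Set X := D ∩ {y | 2 * ε ≤ u y}
  have hE : MeasurableSet E := hD.inter (measurableSet_le measurable_const hm)
  have hEG (y : X) : (u ^ 2) y + ε ^ 2 * c * E.indicator 1 y ≤ G y := by
    by_cases hy : y ∈ E
    · obtain ⟨t, ht, hct⟩ := hcD y hy.1
      rw [indicator_of_mem hy, Pi.one_apply, mul_one]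
      refine le_trans ?_ ((sq_add_act_sub_sq_le hm h0 hb (hu t ht y)).trans (hG ht y))
      rw [Pi.pow_apply]
      gcongr
      calc ε ^ 2 * c ≤ ε ^ 2 * M.act t (B.indicator 1) y := by rw [M.act_indicator hB]; gcongr
        _ = M.act t (fun w => ε ^ 2 * B.indicator 1 w) y := (integral_const_mul _ _).symm
        _ ≤ _ := by
            refine M.act_mono (C := ε ^ 2) (D := C ^ 2)
              ((measurable_one.indicator hB).const_mul _)
              ((hm.sub_const _).pow_const 2) (fun w => ?_) (fun w => ?_) (fun w => ?_) t y
            · rw [abs_mul, abs_of_nonneg (by positivity)]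
              exact mul_le_of_le_one_right (by positivity) (abs_indicator_one_le B w)
            · rw [abs_pow]
              gcongr
              exact abs_sub_le_of_nonneg_of_le (h0 w) (hC w) (h0 y) (hC y)
            · by_cases hw : w ∈ B
              · rw [indicator_of_mem hw, Pi.one_apply, mul_one]
                have : 2 * ε ≤ u y := hy.2
                nlinarith [huB w hw]
              · rw [indicator_of_notMem hw, mul_zero]
                positivity
    · rw [indicator_of_notMem hy, mul_zero, add_zero]
      exact (hsq le_rfl y).trans (hG le_rfl y)
  have hPE {s : ℝ} (hs : 0 ≤ s) :
      M.act s (u ^ 2) x + ε ^ 2 * c * (M.P s x E).toReal ≤ G x := by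
    refine le_trans (le_of_eq ?_) ((integral_mono (μ := M.P s x) ?_
      (integrable_of_abs_le hGm hGb) hEG).trans (hGx hs))
    · rw [integral_add (integrable_of_abs_le hm2 hb2) ((integrable_of_abs_le
        (measurable_one.indicator hE) (abs_indicator_one_le E)).const_mul _), integral_const_mul,
        ← M.act_indicator hE]
      rfl
    · exact (integrable_of_abs_le hm2 hb2).add ((integrable_of_abs_le
        (measurable_one.indicator hE) (abs_indicator_one_le E)).const_mul _)
  obtain ⟨n, hn⟩ := ((hGlim x).eventually
    (lt_mem_nhds (sub_lt_self (G x) (by positivity : 0 < ε ^ 2 * c * η)))).exists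
  obtain ⟨s, hns, hs⟩ := hDx n n.cast_nonneg
  have hs0 : 0 ≤ s := n.cast_nonneg.trans hns
  have hEη : (M.P s x E).toReal ≤ η := by
    have h1 := hPE hs0
    have h2 := hmono n.cast_nonneg hns x
    exact le_of_mul_le_mul_left (by linarith) (by positivity : 0 < ε ^ 2 * c)
  have hDi : Integrable (D.indicator (1 : X → ℝ)) (M.P s x) :=
    integrable_of_abs_le (measurable_one.indicator hD) (abs_indicator_one_le D)
  have hEi : Integrable (E.indicator (1 : X → ℝ)) (M.P s x) :=
    integrable_of_abs_le (measurable_one.indicator hE) (abs_indicator_one_le E)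
  have hle (w : X) : u w ≤ 2 * ε + C * E.indicator 1 w + C * (1 - D.indicator 1 w) := by
    by_cases hD' : w ∈ D
    · by_cases hE' : w ∈ E
      · simp only [indicator_of_mem hD', indicator_of_mem hE', Pi.one_apply]
        linarith [hC w]
      · have : u w < 2 * ε := not_le.1 fun h => hE' ⟨hD', h⟩
        simp only [indicator_of_mem hD', indicator_of_notMem hE', Pi.one_apply]
        linarith
    · have hE' : w ∉ E := fun h => hD' h.1
      simp only [indicator_of_notMem hD', indicator_of_notMem hE']
      linarith [hC w]
  have i1 : Integrable (fun w => 2 * ε + C * E.indicator (1 : X → ℝ) w) (M.P s x) :=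
    (integrable_const _).add (hEi.const_mul C)
  have i2 : Integrable (fun w => C * (1 - D.indicator (1 : X → ℝ) w)) (M.P s x) :=
    ((integrable_const _).sub hDi).const_mul C
  have key := integral_mono (μ := M.P s x) (integrable_of_abs_le hm hb) (i1.add i2) hle
  rw [integral_add' i1 i2, integral_add (integrable_const _) (hEi.const_mul C),
    integral_const_mul C, integral_const_mul C, integral_sub (integrable_const _) hDi,
    integral_indicator_one hE, integral_indicator_one hD, integral_const, integral_const,
    probReal_univ, one_smul, one_smul] at key
  have k1 : u x ≤ ∫ w, u w ∂(M.P s x) := hu s hs0 x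
  have k2 : C * (M.P s x).real E ≤ C * η := mul_le_mul_of_nonneg_left hEη hC0
  have k3 : C * (1 - (M.P s x).real D) ≤ C * η :=
    mul_le_mul_of_nonneg_left (by rw [measureReal_def]; linarith) hC0
  linarith

end Subharmonic

section Convergence

variable {X : Type*} [MeasurableSpace X] {M : MarkovSemigroup X}

lemma abs_avg_sub_le_act_add {f : X → ℝ} (hf : Measurable f) {C : ℝ} (hC : ∀ x, |f x| ≤ C)
    {T s : ℝ} (hT : 0 < T) (hs : 0 ≤ s) (a : ℝ) (y : X) :
    |M.avg T f y - a| ≤ M.act s (fun w => |M.avg T f w - a|) y + 2 * C * s / T := by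
  have h1 := M.abs_avg_act_sub_avg_le hf hC hs hT y
  have h2 : |M.act s (M.avg T f) y - a| ≤ M.act s (fun w => |M.avg T f w - a|) y := by
    have : M.act s (M.avg T f) y - a = ∫ w, (M.avg T f w - a) ∂(M.P s y) := by
      rw [integral_sub (integrable_of_abs_le (M.measurable_avg hf hT) (M.abs_avg_le hC hT))
        (integrable_const _), integral_const, probReal_univ, one_smul]
      rfl
    rw [this]
    exact abs_integral_le_integral_abs
  rw [M.act_avg hf hC hs hT] at h2
  rw [abs_sub_comm] at h1
  linarith [abs_sub_le (M.avg T f y) (M.avg T (M.act s f) y) a]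

lemma Invariant.integral_QM {μ : Measure X} [IsProbabilityMeasure μ] (hμ : M.Invariant μ)
    {f : X → ℝ} (hf : Measurable f) {C : ℝ} (hC : ∀ x, |f x| ≤ C) {T : ℝ} (hT : 0 < T) :
    ∫ x, f x ∂(M.QM T μ) = ∫ x, f x ∂μ := by
  rw [M.integral_QM hf hC hT, M.integral_avg hf hC hT, intervalIntegral.integral_congr
    (g := fun _ => ∫ x, f x ∂μ) fun s hs => ?_]
  · rw [intervalIntegral.integral_const, sub_zero, smul_eq_mul, inv_mul_cancel_left₀ hT.ne']
  · rw [uIcc_of_le hT.le] at hs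
    dsimp only
    rw [← M.integral_dual hf hC, hμ s hs.1]

variable [PseudoMetricSpace X] [BorelSpace X]

/-- Time averages started from different points merge. -/
lemma EProperty.tendsto_avg_sub_avg (hE : M.EProperty) {z : X}
    (hlow : ∀ δ > 0, ∀ D, Bornology.IsBounded D → ∃ c > 0, ∀ y ∈ D, ∃ t, 0 ≤ t ∧
      c ≤ (M.P t y (ball z δ)).toReal)
    (hconc : ∀ x, ∀ η > 0, ∃ D, Bornology.IsBounded D ∧ MeasurableSet D ∧
      ∀ S, 0 ≤ S → ∃ s, S ≤ s ∧ 1 - η ≤ (M.P s x D).toReal)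
    {ψ : X → ℝ} (hψ : IsBddLipschitz ψ) (x : X) :
    Tendsto (fun T => M.avg T ψ x - M.avg T ψ z) atTop (𝓝 0) := by
  obtain ⟨C, hC⟩ := hψ.2
  have hm : Measurable ψ := hψ.1.choose_spec.continuous.measurable
  refine tendsto_of_seq_tendsto fun T hT => ?_
  let τ : ℕ → ℝ := fun k => max (T k) 1
  have hτ0 (k : ℕ) : 0 < τ k := zero_lt_one.trans_le (le_max_right _ _)
  have hτ : Tendsto τ atTop atTop := tendsto_atTop_mono (fun k => le_max_left _ _) hT
  let v : ℕ → X → ℝ := fun k y => |M.avg (τ k) ψ y - M.avg (τ k) ψ z|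
  have hvm (k : ℕ) : Measurable (v k) := by
    have := (M.measurable_avg hm (hτ0 k)).sub_const (M.avg (τ k) ψ z)
    exact this.norm
  have hv0 (k : ℕ) (y : X) : 0 ≤ v k y := abs_nonneg _
  have hvC (k : ℕ) (y : X) : v k y ≤ C + C :=
    (abs_sub _ _).trans (add_le_add (M.abs_avg_le hC (hτ0 k) y) (M.abs_avg_le hC (hτ0 k) z))
  let U : ℕ → X → ℝ := fun m y => ⨆ n, v (m + n) y
  have hUb (m : ℕ) (y : X) : BddAbove (range fun n => v (m + n) y) :=
    ⟨C + C, forall_mem_range.2 fun n => hvC _ y⟩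
  have hvU {m k : ℕ} (h : m ≤ k) (y : X) : v k y ≤ U m y := by
    obtain ⟨n, rfl⟩ := Nat.exists_eq_add_of_le h
    exact le_ciSup (hUb m y) n
  have hUm (m : ℕ) : Measurable (U m) := Measurable.iSup fun n => hvm _
  have hU0 (m : ℕ) (y : X) : 0 ≤ U m y := (hv0 m y).trans (hvU le_rfl y)
  have hUC (m : ℕ) (y : X) : U m y ≤ C + C := ciSup_le fun n => hvC _ y
  have hUabs (m : ℕ) (y : X) : |U m y| ≤ C + C := by rw [abs_of_nonneg (hU0 m y)]; exact hUC m y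
  have hUanti (y : X) : Antitone (U · y) := fun i j hij =>
    ciSup_le fun n => hvU (hij.trans (Nat.le_add_right j n)) y
  let u : X → ℝ := fun y => ⨅ m, U m y
  have hub (y : X) : BddBelow (range (U · y)) := ⟨0, forall_mem_range.2 fun m => hU0 m y⟩
  have hUu (y : X) : Tendsto (U · y) atTop (𝓝 (u y)) := tendsto_atTop_ciInf (hUanti y) (hub y)
  have hsub (s : ℝ) (hs : 0 ≤ s) (y : X) : u y ≤ M.act s u y := by
    refine ge_of_tendsto (tendsto_act_of_abs_le hUm hUabs hUu s y) (Eventually.of_forall fun m => ?_)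
    refine le_of_forall_pos_le_add fun ε hε => ?_
    have hlim : Tendsto (fun k => 2 * C * s / τ k) atTop (𝓝 0) := tendsto_const_nhds.div_atTop hτ
    obtain ⟨j, hj⟩ := eventually_atTop.1 (hlim.eventually (ge_mem_nhds hε))
    refine (ciInf_le (hub y) (max m j)).trans (ciSup_le fun n => ?_)
    refine (abs_avg_sub_le_act_add hm hC (hτ0 _) hs _ y).trans (add_le_add ?_ (hj _ (by omega)))
    exact M.act_mono (hvm _) (hUm m) (C := C + C)
      (fun w => by rw [abs_of_nonneg (hv0 _ w)]; exact hvC _ w) (hUabs m) (hvU (by omega)) s y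
  have hux : u x ≤ 0 := by
    refine le_of_forall_pos_le_add fun ε hε => ?_
    obtain ⟨δ, hδ, h⟩ := hE ψ hψ z (ε / 2) (by positivity)
    have := le_two_mul_of_forall_le_act (u := u) (C := C + C) (x := x) (Measurable.iInf hUm)
      (fun y => le_ciInf fun m => hU0 m y) (fun y => (ciInf_le (hub y) 0).trans (hUC 0 y)) hsub
      (measurableSet_ball (x := z) (ε := δ)) (half_pos hε)
      (fun y hy => (ciInf_le (hub y) 0).trans (ciSup_le fun n =>
        M.abs_avg_sub_avg_le hm hC (hτ0 _) fun s hs => (h y hy s hs).le)) (hlow δ hδ) (hconc x)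
    linarith
  have hv : Tendsto (v · x) atTop (𝓝 0) := by
    refine tendsto_order.2 ⟨fun b hb => Eventually.of_forall fun k => hb.trans_le (hv0 k x),
      fun b hb => ?_⟩
    obtain ⟨m, hm⟩ := exists_lt_of_ciInf_lt (hux.trans_lt hb)
    filter_upwards [eventually_ge_atTop m] with k hk using (hvU hk x).trans_lt hm
  refine ((tendsto_zero_iff_abs_tendsto_zero _).2 hv).congr' ?_
  filter_upwards [hT.eventually_ge_atTop 1] with k hk
  simp only [τ, max_eq_left hk, Function.comp_apply]

/-- If time averages started from different points merge, then an invariant probability measure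
attracts all time averages. -/
lemma Invariant.weakStarMeanErgodic {μ : Measure X} [IsProbabilityMeasure μ] (hμ : M.Invariant μ)
    {z : X} (h : ∀ ψ, IsBddLipschitz ψ → ∀ x,
      Tendsto (fun T => M.avg T ψ x - M.avg T ψ z) atTop (𝓝 0)) : M.WeakStarMeanErgodic μ := by
  intro ν hν f hf
  let q : ℝ → ProbabilityMeasure X := fun T => ⟨M.QM T ν, M.isProbabilityMeasure_QM T ν⟩
  let p : ProbabilityMeasure X := ⟨μ, inferInstance⟩
  have hq : Tendsto q atTop (𝓝 p) := by
    rw [tendsto_iff_forall_lipschitz_integral_tendsto]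
    rintro ψ ⟨C, hC⟩ ⟨L, hL⟩
    have hb (x : X) : |ψ x| ≤ |ψ z| + C := by
      have := hC x z
      rw [Real.dist_eq] at this
      linarith [abs_sub_abs_le_abs_sub (ψ x) (ψ z)]
    have hm : Measurable ψ := hL.continuous.measurable
    have hlim (ρ : Measure X) [IsProbabilityMeasure ρ] :
        Tendsto (fun T => (∫ x, ψ x ∂(M.QM T ρ)) - M.avg T ψ z) atTop (𝓝 0) := by
      have := tendsto_integral_filter_of_dominated_convergence (μ := ρ) (l := atTop)
        (F := fun T x => M.avg T ψ x - M.avg T ψ z) (f := fun _ => 0)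
        (fun _ => (|ψ z| + C) + (|ψ z| + C))
        ((eventually_gt_atTop 0).mono fun T hT =>
          ((M.measurable_avg hm hT).sub_const _).aestronglyMeasurable)
        ((eventually_gt_atTop 0).mono fun T hT => Eventually.of_forall fun x =>
          (abs_sub _ _).trans (add_le_add (M.abs_avg_le hb hT x) (M.abs_avg_le hb hT z)))
        (integrable_const _) (Eventually.of_forall (h ψ ⟨⟨L, hL⟩, _, hb⟩))
      rw [integral_zero] at this
      refine this.congr' ?_
      filter_upwards [eventually_gt_atTop 0] with T hT
      rw [integral_sub (integrable_of_abs_le (M.measurable_avg hm hT) (M.abs_avg_le hb hT))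
        (integrable_const _), integral_const, probReal_univ, one_smul, M.integral_QM hm hb hT]
    have := ((hlim ν).sub (hlim μ)).add_const (∫ x, ψ x ∂μ)
    rw [sub_zero, zero_add] at this
    refine this.congr' ?_
    filter_upwards [eventually_gt_atTop 0] with T hT
    rw [hμ.integral_QM hm hb hT]
    simp only [q, ProbabilityMeasure.coe_mk]
    ring
  obtain ⟨C, hC⟩ := hf.2
  exact (ProbabilityMeasure.tendsto_iff_forall_integral_tendsto.1 hq)
    (BoundedContinuousFunction.ofNormedAddCommGroup f hf.1 C hC)

lemma WeakStarMeanErgodic.eq_of_invariant {μ ν : Measure X} [IsProbabilityMeasure μ]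
    [IsProbabilityMeasure ν] (h : M.WeakStarMeanErgodic μ) (hν : M.Invariant ν) : ν = μ := by
  refine ext_of_forall_integral_eq_of_IsFiniteMeasure fun f => ?_
  have hf := f.isBddContinuous
  refine tendsto_nhds_unique (tendsto_const_nhds.congr' ?_) (h ν inferInstance f hf)
  filter_upwards [eventually_gt_atTop 0] with T hT
  exact (hν.integral_QM hf.1.measurable f.norm_coe_le_norm hT).symm

end Convergence

end MarkovSemigroup

/-- Theorem 2 of the paper. Under the e-property, a lower bound for
ergodic averages of balls around `z` which is uniform over bounded sets, and uniform
concentration of ergodic averages on bounded sets, the semigroup has a unique invariant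
probability measure and is weak-* mean ergodic. -/
theorem weakStarMeanErgodic_of_uniform_lower_bound
    {X : Type*} [MetricSpace X] [CompleteSpace X] [SecondCountableTopology X]
    [MeasurableSpace X] [BorelSpace X]
    (M : MarkovSemigroup X)
    (hFeller : M.Feller) (hSC : M.StochasticallyContinuous) (hE : M.EProperty)
    (z : X)
    (hlow : ∀ A : Set X, Bornology.IsBounded A → ∀ δ : ℝ, 0 < δ →
      ∃ c : ℝ, 0 < c ∧ ∀ x ∈ A,
        c ≤ Filter.liminf (fun T : ℝ => ((M.Q T x) (Metric.ball z δ)).toReal)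
          Filter.atTop)
    (hconc : ∀ ε : ℝ, 0 < ε → ∀ x : X, ∃ D : Set X,
      Bornology.IsBounded D ∧ MeasurableSet D ∧
      1 - ε < Filter.liminf (fun T : ℝ => ((M.Q T x) D).toReal) Filter.atTop) :
    ∃ μstar : MeasureTheory.Measure X,
      MeasureTheory.IsProbabilityMeasure μstar ∧ M.Invariant μstar ∧
      (∀ μ : MeasureTheory.Measure X, MeasureTheory.IsProbabilityMeasure μ →
        M.Invariant μ → μ = μstar) ∧
      M.WeakStarMeanErgodic μstar := by
  have hlow' (A : Set X) (hA : Bornology.IsBounded A) (δ : ℝ) (hδ : 0 < δ) : ∃ c > 0, ∀ x ∈ A,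
      c < liminf (fun T : ℝ => (M.Q T x (ball z δ)).toReal) atTop := by
    obtain ⟨c, hc, h⟩ := hlow A hA δ hδ
    exact ⟨c / 2, half_pos hc, fun x hx => (half_lt_self hc).trans_le (h x hx)⟩
  obtain ⟨μ, hμ, hinv⟩ := hE.exists_invariant (z := z) hFeller fun δ hδ => by
    obtain ⟨c, hc, h⟩ := hlow' {z} Bornology.isBounded_singleton δ hδ
    exact ⟨c, hc, M.eventually_lt_avg_of_lt_liminf measurableSet_ball (h z rfl)⟩
  have herg : M.WeakStarMeanErgodic μ := by
    refine hinv.weakStarMeanErgodic (z := z) fun ψ hψ x =>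
      hE.tendsto_avg_sub_avg (fun δ hδ D hD => ?_) (fun y η hη => ?_) hψ x
    · obtain ⟨c, hc, h⟩ := hlow' D hD δ hδ
      exact ⟨c, hc, fun y hy => M.exists_le_act_of_lt_liminf measurableSet_ball (h y hy) le_rfl⟩
    · obtain ⟨D, hDb, hD, h⟩ := hconc η hη y
      exact ⟨D, hDb, hD, fun S hS => M.exists_le_act_of_lt_liminf hD h hS⟩
  exact ⟨μ, hμ, hinv, fun ν _ hν => herg.eq_of_invariant hν, herg⟩
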